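/- The Somos-5 QRT map φ(x,y) = (y, (α̃y+β̃)/(xy)) preserves the pencil of biquadratic curves: if xy(x+y) + α̃(x+y) + β̃ - J̃·xy = 0 with x,y ≠ 0, then the image point satisfies the same equation with the same J̃. -/

import Mathlib

/-- The Somos-5 QRT map preserves the pencil of biquadratic curves. -/
theorem somos5_qrt_preserves_pencil {F : Type*} [Field F] (α β J x y : F)
    (hx : x ≠ 0) (hy : y ≠ 0)
    (h : x * y * (x + y) + α * (x + y) + β - J * (x * y) = 0) :
    y * ((α * y + β) / (x * y)) * (y + (α * y + β) / (x * y)) +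
      α * (y + (α * y + β) / (x * y)) + β -
      J * (y * ((α * y + β) / (x * y))) = 0 := by
  have key : y * ((α * y + β) / (x * y)) * (y + (α * y + β) / (x * y)) +
      α * (y + (α * y + β) / (x * y)) + β - J * (y * ((α * y + β) / (x * y))) =
      (α * y + β) / (x ^ 2 * y) *
        (x * y * (x + y) + α * (x + y) + β - J * (x * y)) := by
    field_simp
    ring
  rw [key, h, mul_zero]
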